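/- There exists a constant $c > 0$ such that for every integer $k \ge 1$ there exist $n$ and a $k$-ambiguous profile of independent value distributions $F_1,\dots,F_n$ with $\sum_{i=1}^n \sup_{p>0} p\cdot\Pr_{F_i}[v_i \ge p] > 0$, such that every symmetric, DSIC, ex-post IR digital-goods mechanism has expected revenue at most $\frac{c}{k}\sum_{i=1}^n \sup_{p>0} p\cdot\Pr_{F_i}[v_i \ge p]$. Hence the $O(k)$ approximation guarantee of anonymous mechanisms for $k$-ambiguous distributions is tight. -/

import Mathlib

open MeasureTheory
open scoped ENNReal

/-- All bids are nonnegative. -/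
def NonnegBids {n : ℕ} (v : Fin n → ℝ) : Prop := ∀ i, 0 ≤ v i

/-- Dominant strategy incentive compatibility of a digital-goods mechanism. -/
def IsDSIC {n : ℕ} (A P : (Fin n → ℝ) → Fin n → ℝ) : Prop :=
  ∀ v : Fin n → ℝ, NonnegBids v → ∀ (i : Fin n) (w : ℝ), 0 ≤ w →
    A (Function.update v i w) i * v i - P (Function.update v i w) i ≤
      A v i * v i - P v i

/-- Ex-post individual rationality. -/
def IsExPostIR {n : ℕ} (A P : (Fin n → ℝ) → Fin n → ℝ) : Prop :=
  ∀ v : Fin n → ℝ, NonnegBids v → ∀ i : Fin n, 0 ≤ A v i * v i - P v i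

/-- Anonymity (symmetry): permuting the bids permutes the outcome. -/
def IsAnonymous {n : ℕ} (Q : (Fin n → ℝ) → Fin n → ℝ) : Prop :=
  ∀ (π : Equiv.Perm (Fin n)) (v : Fin n → ℝ), NonnegBids v →
    ∀ i : Fin n, Q (v ∘ π) i = Q v (π i)

/-- Allocations lie in `[0,1]`. -/
def ValidAlloc {n : ℕ} (A : (Fin n → ℝ) → Fin n → ℝ) : Prop :=
  ∀ v : Fin n → ℝ, NonnegBids v → ∀ i : Fin n, 0 ≤ A v i ∧ A v i ≤ 1

/-- The law of a value equal to `h` with probability `p` and to `0` otherwise. -/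
noncomputable def twoPoint (p h : ℝ) : Measure ℝ :=
  ENNReal.ofReal (1 - p) • Measure.dirac 0 + ENNReal.ofReal p • Measure.dirac h

section TwoPoint

variable {p h : ℝ}

theorem isProbabilityMeasure_twoPoint (hp0 : 0 ≤ p) (hp1 : p ≤ 1) :
    IsProbabilityMeasure (twoPoint p h) := by
  constructor
  simp only [twoPoint, Measure.add_apply, Measure.smul_apply, measure_univ, smul_eq_mul, mul_one]
  rw [← ENNReal.ofReal_add (by linarith) hp0]
  simp

theorem ae_twoPoint : ∀ᵐ x ∂twoPoint p h, x = 0 ∨ x = h := by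
  rw [twoPoint, ae_add_measure_iff]
  constructor
  · refine Measure.ae_smul_measure ?_ _
    simp [ae_dirac_eq]
  · refine Measure.ae_smul_measure ?_ _
    simp [ae_dirac_eq]

theorem twoPoint_compl_Icc (hh : 0 ≤ h) : twoPoint p h (Set.Icc 0 h)ᶜ = 0 := by
  have : ∀ᵐ x ∂twoPoint p h, x ∈ Set.Icc 0 h := by
    filter_upwards [ae_twoPoint] with x hx
    rcases hx with rfl | rfl
    · exact ⟨le_rfl, hh⟩
    · exact ⟨hh, le_rfl⟩
  exact this

theorem integrable_id_twoPoint : Integrable (fun x => x) (twoPoint p h) := by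
  refine Integrable.add_measure ?_ ?_
  · exact (integrable_dirac (by simp)).smul_measure (by simp)
  · exact (integrable_dirac (by simp)).smul_measure (by simp)

theorem integral_id_twoPoint (hp0 : 0 ≤ p) : ∫ x, x ∂twoPoint p h = p * h := by
  rw [twoPoint, integral_add_measure, integral_smul_measure, integral_smul_measure]
  · simp [hp0]
  · exact (integrable_dirac (by simp)).smul_measure (by simp)
  · exact (integrable_dirac (by simp)).smul_measure (by simp)

theorem le_iSup_twoPoint (hp0 : 0 ≤ p) (hp1 : p ≤ 1) (hh : 0 < h) :
    p * h ≤ ⨆ (q : ℝ) (_ : 0 < q), q * (twoPoint p h {x | q ≤ x}).toReal := by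
  have := isProbabilityMeasure_twoPoint (h := h) hp0 hp1
  have hbdd : BddAbove (Set.range fun q : ℝ =>
      ⨆ (_ : 0 < q), q * (twoPoint p h {x | q ≤ x}).toReal) := by
    refine ⟨h, ?_⟩
    rintro _ ⟨q, rfl⟩
    refine Real.iSup_le (fun hq => ?_) hh.le
    rcases le_or_gt q h with hqh | hqh
    · have h1 : (twoPoint p h {x | q ≤ x}).toReal ≤ 1 := measureReal_le_one
      nlinarith
    · have h0 : twoPoint p h {x | q ≤ x} = 0 := by
        have : ∀ᵐ x ∂twoPoint p h, ¬ q ≤ x := by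
          filter_upwards [ae_twoPoint] with x hx
          rcases hx with rfl | rfl <;> linarith
        simpa [ae_iff] using this
      simp [h0, hh.le]
  refine le_trans ?_ (le_ciSup hbdd h)
  have hmass : p ≤ (twoPoint p h {x | h ≤ x}).toReal := by
    have hle : ENNReal.ofReal p ≤ twoPoint p h {x | h ≤ x} := by
      simp [twoPoint]
    exact (ENNReal.ofReal_le_iff_le_toReal (measure_ne_top _ _)).1 hle
  simp only [hh, ciSup_unique]
  nlinarith

end TwoPoint

theorem sum_range_inv_two_pow_le (n : ℕ) : ∑ i ∈ Finset.range n, (2 ^ i : ℝ)⁻¹ ≤ 2 := by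
  have : ∑ i ∈ Finset.range n, (2 ^ i : ℝ)⁻¹ = 2 - 2 * (2 ^ n : ℝ)⁻¹ := by
    induction n with
    | zero => simp
    | succ m ih => rw [Finset.sum_range_succ, ih, pow_succ]; field_simp; ring
  rw [this]
  have : (0 : ℝ) < (2 ^ n)⁻¹ := by positivity
  linarith

/-- Under a single-parameter incentive constraint, geometrically weighted payments at the values
`2 ^ i` telescope to at most twice an allocation probability. -/
theorem sum_range_payment_le {α g : ℝ → ℝ} (hα0 : ∀ x, 0 ≤ x → 0 ≤ α x)
    (hα1 : ∀ x, 0 ≤ x → α x ≤ 1)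
    (hic : ∀ x y, 0 ≤ x → 0 ≤ y → α y * x - g y ≤ α x * x - g x) (n : ℕ) :
    ∑ i ∈ Finset.range n, (2 ^ i : ℝ)⁻¹ * (g (2 ^ i) - g 0) ≤ 2 := by
  have key : ∀ m : ℕ, ∑ i ∈ Finset.range (m + 1), (2 ^ i : ℝ)⁻¹ * (g (2 ^ i) - g 0)
      + (2 ^ m : ℝ)⁻¹ * (g (2 ^ m) - g 0) ≤ 2 * α (2 ^ m) := by
    intro m
    induction m with
    | zero =>
      have h1 := hic 1 0 zero_le_one le_rfl
      have h2 := hα0 0 le_rfl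
      simp
      linarith
    | succ m ih =>
      rw [Finset.sum_range_succ]
      have h1 := hic (2 ^ (m + 1)) (2 ^ m) (by positivity) (by positivity)
      have hpos : (0 : ℝ) < (2 ^ m)⁻¹ := by positivity
      have h2 : (2 ^ m : ℝ)⁻¹ * (g (2 ^ (m + 1)) - g (2 ^ m)) ≤
          2 * (α (2 ^ (m + 1)) - α (2 ^ m)) := by
        calc (2 ^ m : ℝ)⁻¹ * (g (2 ^ (m + 1)) - g (2 ^ m))
            ≤ (2 ^ m : ℝ)⁻¹ * ((α (2 ^ (m + 1)) - α (2 ^ m)) * 2 ^ (m + 1)) := by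
              gcongr; linarith
          _ = 2 * (α (2 ^ (m + 1)) - α (2 ^ m)) := by
              rw [pow_succ]; field_simp
      have h3 : (2 ^ (m + 1) : ℝ)⁻¹ = (2 ^ m : ℝ)⁻¹ / 2 := by
        rw [pow_succ]; field_simp
      rw [h3]
      linarith
  cases n with
  | zero => simp
  | succ m =>
    have h1 := key m
    have h2 := hα1 (2 ^ m) (by positivity)
    have h3 := hic 0 (2 ^ m) le_rfl (by positivity)
    have h4 : 0 ≤ (2 ^ m : ℝ)⁻¹ * (g (2 ^ m) - g 0) :=
      mul_nonneg (by positivity) (by linarith)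
    linarith

theorem nonnegBids_update_zero {n : ℕ} (i : Fin n) {x : ℝ} (hx : 0 ≤ x) :
    NonnegBids (Function.update (0 : Fin n → ℝ) i x) := by
  intro j
  by_cases h : j = i
  · subst h; simpa
  · simp [h]

theorem IsAnonymous.update_zero {n : ℕ} {Q : (Fin n → ℝ) → Fin n → ℝ} (hQ : IsAnonymous Q)
    (i j : Fin n) {x : ℝ} (hx : 0 ≤ x) :
    Q (Function.update 0 i x) i = Q (Function.update 0 j x) j := by
  have h := hQ (Equiv.swap i j) _ (nonnegBids_update_zero j hx) i
  rw [Equiv.swap_apply_left] at h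
  rw [← h]
  congr 1
  funext l
  simp only [Function.comp, Function.update_apply, Equiv.swap_apply_def]
  split_ifs <;> simp_all

/-- Pointwise payment bound when bidder `j` has value `0` or `h j`: either all competitors of `i`
bid zero, or bidder `i` pays at most its value. -/
theorem payment_le_of_two_values {n : ℕ} {A P : (Fin n → ℝ) → Fin n → ℝ} (hA : ValidAlloc A)
    (hIC : IsDSIC A P) (hIR : IsExPostIR A P) {h : Fin n → ℝ} (hh : ∀ i, 0 < h i)
    {v : Fin n → ℝ} (hv : ∀ i, v i = 0 ∨ v i = h i) (i : Fin n) :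
    P v i ≤ (h i)⁻¹ * (P (Function.update 0 i (h i)) i - P 0 i) * v i
      + ∑ j ∈ Finset.univ.erase i, (h j)⁻¹ * (v i * v j) := by
  have hv0 : NonnegBids v := fun j => by
    rcases hv j with e | e <;> rw [e]
    exact (hh j).le
  have hz : NonnegBids (0 : Fin n → ℝ) := fun j => le_rfl
  have hPv : P v i ≤ v i := by
    have h1 := hIR v hv0 i
    have h2 := (hA v hv0 i).2
    have h3 := hv0 i
    nlinarith
  have hP0 : P 0 i ≤ 0 := by simpa using hIR 0 hz i
  have hmono : P 0 i ≤ P (Function.update 0 i (h i)) i := by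
    have := hIC 0 hz i (h i) (hh i).le
    simpa using this
  have hterm : ∀ j ∈ Finset.univ.erase i, 0 ≤ (h j)⁻¹ * (v i * v j) := fun j _ =>
    mul_nonneg (inv_nonneg.2 (hh j).le) (mul_nonneg (hv0 i) (hv0 j))
  by_cases hz' : ∃ j, j ≠ i ∧ v j ≠ 0
  · obtain ⟨j, hji, hvj⟩ := hz'
    have hvj' : v j = h j := (hv j).resolve_left hvj
    have h1 := Finset.single_le_sum hterm (Finset.mem_erase.2 ⟨hji, Finset.mem_univ j⟩)
    have h2 : (h j)⁻¹ * (v i * v j) = v i := by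
      rw [hvj']; have := (hh j).ne'; field_simp
    have h3 : 0 ≤ (h i)⁻¹ * (P (Function.update 0 i (h i)) i - P 0 i) * v i :=
      mul_nonneg (mul_nonneg (inv_nonneg.2 (hh i).le) (by linarith)) (hv0 i)
    linarith
  · push Not at hz'
    have hveq : v = Function.update (0 : Fin n → ℝ) i (v i) := by
      funext j
      by_cases hj : j = i
      · subst hj; simp
      · simp [hj, hz' j hj]
    have h4 := Finset.sum_nonneg hterm
    rcases hv i with e | e
    · rw [e] at hPv
      simp only [e, mul_zero, zero_mul, Finset.sum_const_zero, add_zero]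
      exact hPv
    · have h5 : (h i)⁻¹ * (P (Function.update 0 i (h i)) i - P 0 i) * v i = P v i - P 0 i := by
        rw [e] at hveq
        rw [← hveq, e]; have := (hh i).ne'; field_simp
      linarith

section Product

variable {n : ℕ} {F : Fin n → Measure ℝ} [∀ i, IsProbabilityMeasure (F i)]

theorem integrable_eval_pi (hF : ∀ i, Integrable (fun x => x) (F i)) (i : Fin n) :
    Integrable (fun v : Fin n → ℝ => v i) (Measure.pi F) :=
  (measurePreserving_eval F i).integrable_comp_of_integrable (hF i)

theorem integral_eval_pi (i : Fin n) :
    ∫ v, v i ∂Measure.pi F = ∫ x, x ∂F i := by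
  have h := measurePreserving_eval F i
  rw [← h.map_eq, integral_map h.measurable.aemeasurable (by fun_prop)]

theorem indepFun_eval_pi {i j : Fin n} (hij : i ≠ j) :
    ProbabilityTheory.IndepFun (fun v : Fin n → ℝ => v i) (fun v => v j) (Measure.pi F) :=
  (ProbabilityTheory.iIndepFun_pi (μ := F) (X := fun _ x => x)
    (fun _ => aemeasurable_id)).indepFun hij

end Product

/-- **Tightness of the `O(k)` guarantee for `k`-ambiguous distributions.**
There is a constant `c > 0` such that for every `k ≥ 1` there are `n` and a
`k`-ambiguous profile of independent value distributions (supports in `[a i, b i]`,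
`a` decreasing, `b i < a j` whenever `j + k + 1 ≤ i`, 0-indexed) with positive
personalized posted-price optimal revenue, such that every symmetric, DSIC,
ex-post IR digital-goods mechanism extracts at most a `c/k` fraction of it. -/
theorem k_ambiguous_tightness :
    ∃ c : ℝ, 0 < c ∧
      ∀ k : ℕ, 1 ≤ k →
        ∃ (n : ℕ) (F : Fin n → Measure ℝ) (a b : Fin n → ℝ),
          (∀ i, IsProbabilityMeasure (F i)) ∧
          (∀ i, 0 ≤ a i) ∧
          (∀ i j : Fin n, i ≤ j → a j ≤ a i) ∧
          (∀ i, F i (Set.Icc (a i) (b i))ᶜ = 0) ∧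
          (∀ i j : Fin n, (j : ℕ) + k + 1 ≤ (i : ℕ) → b i < a j) ∧
          0 < (∑ i, ⨆ (p : ℝ) (_ : 0 < p), p * ((F i) {x | p ≤ x}).toReal) ∧
          ∀ A P : (Fin n → ℝ) → Fin n → ℝ,
            (∀ i, Measurable fun v => A v i) → (∀ i, Measurable fun v => P v i) →
            ValidAlloc A → IsAnonymous A → IsAnonymous P →
            IsDSIC A P → IsExPostIR A P →
            (∫ v, ∑ i, P v i ∂(Measure.pi F)) ≤
              (c / k) *
                (∑ i, ⨆ (p : ℝ) (_ : 0 < p), p * ((F i) {x | p ≤ x}).toReal) := by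
  refine ⟨4, by norm_num, fun k hk => ?_⟩
  have hk1 : (1 : ℝ) ≤ k := by exact_mod_cast hk
  have hk0 : (0 : ℝ) < k := by linarith
  set h : Fin k → ℝ := fun i => 2 ^ (i : ℕ) with hdef
  set p : Fin k → ℝ := fun i => (k : ℝ)⁻¹ * (h i)⁻¹ with pdef
  have hh1 : ∀ i, 1 ≤ h i := fun i => one_le_pow₀ one_le_two
  have hh : ∀ i, 0 < h i := fun i => zero_lt_one.trans_le (hh1 i)
  have hp0 : ∀ i, 0 ≤ p i := fun i =>
    mul_nonneg (inv_nonneg.2 hk0.le) (inv_nonneg.2 (hh i).le)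
  have hp1 : ∀ i, p i ≤ 1 := fun i =>
    mul_le_one₀ (inv_le_one_of_one_le₀ hk1) (inv_nonneg.2 (hh i).le)
      (inv_le_one_of_one_le₀ (hh1 i))
  have hph : ∀ i, p i * h i = (k : ℝ)⁻¹ := fun i => by
    rw [pdef]; exact inv_mul_cancel_right₀ (hh i).ne' _
  set F : Fin k → Measure ℝ := fun i => twoPoint (p i) (h i) with Fdef
  have hprob : ∀ i, IsProbabilityMeasure (F i) := fun i =>
    isProbabilityMeasure_twoPoint (hp0 i) (hp1 i)
  have hopt : 1 ≤ ∑ i, ⨆ (q : ℝ) (_ : 0 < q), q * ((F i) {x | q ≤ x}).toReal := by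
    calc (1 : ℝ) = ∑ i : Fin k, p i * h i := by
          simp only [hph, Finset.sum_const, Finset.card_univ, Fintype.card_fin, nsmul_eq_mul]
          field_simp
      _ ≤ _ := Finset.sum_le_sum fun i _ => le_iSup_twoPoint (hp0 i) (hp1 i) (hh i)
  refine ⟨k, F, 0, h, hprob, fun _ => le_rfl, fun _ _ _ => le_rfl,
    fun i => twoPoint_compl_Icc (hh i).le, fun i j hij => by omega, by linarith, ?_⟩
  intro A P _ _ hA _ hPsym hIC hIR
  suffices hrev : (∫ v, ∑ i, P v i ∂(Measure.pi F)) ≤ 4 / k from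
    hrev.trans (le_mul_of_one_le_right (by positivity) hopt)
  by_cases hint : Integrable (fun v => ∑ i, P v i) (Measure.pi F)
  swap
  · rw [integral_undef hint]; positivity
  have hFint : ∀ i, Integrable (fun x => x) (F i) := fun i => integrable_id_twoPoint
  have hmean : ∀ i, ∫ v, v i ∂Measure.pi F = (k : ℝ)⁻¹ := fun i => by
    rw [integral_eval_pi, Fdef, integral_id_twoPoint (hp0 i), hph]
  have hIint := integrable_eval_pi hFint
  have hIint2 : ∀ i j : Fin k, i ≠ j →
      Integrable (fun v : Fin k → ℝ => v i * v j) (Measure.pi F) := fun i j hij =>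
    (indepFun_eval_pi hij).integrable_mul (hIint i) (hIint j)
  have hmean2 : ∀ i j : Fin k, i ≠ j →
      ∫ v, v i * v j ∂Measure.pi F = (k : ℝ)⁻¹ * (k : ℝ)⁻¹ := fun i j hij => by
    rw [(indepFun_eval_pi hij).integral_fun_mul_eq_mul_integral
      (hIint i).aestronglyMeasurable (hIint j).aestronglyMeasurable, hmean, hmean]
  have hsupp : ∀ᵐ v ∂Measure.pi F, ∀ i, v i = 0 ∨ v i = h i := by
    rw [ae_all_iff]
    exact fun i => (measurePreserving_eval F i).quasiMeasurePreserving.ae ae_twoPoint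
  set G : Fin k → ℝ := fun i => (h i)⁻¹ * (P (Function.update 0 i (h i)) i - P 0 i) with Gdef
  have hI1 : ∀ i, Integrable (fun v : Fin k → ℝ => G i * v i) (Measure.pi F) :=
    fun i => (hIint i).const_mul _
  have hI2 : ∀ i, ∀ j ∈ Finset.univ.erase i,
      Integrable (fun v : Fin k → ℝ => (h j)⁻¹ * (v i * v j)) (Measure.pi F) :=
    fun i j hj => (hIint2 i j (Finset.ne_of_mem_erase hj).symm).const_mul _
  have hI3 : ∀ i, Integrable (fun v : Fin k → ℝ =>
      ∑ j ∈ Finset.univ.erase i, (h j)⁻¹ * (v i * v j)) (Measure.pi F) :=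
    fun i => integrable_finsetSum _ (hI2 i)
  have hI4 : ∀ i, Integrable (fun v : Fin k → ℝ =>
      G i * v i + ∑ j ∈ Finset.univ.erase i, (h j)⁻¹ * (v i * v j)) (Measure.pi F) :=
    fun i => (hI1 i).add (hI3 i)
  have hsumh : ∑ i, (h i)⁻¹ ≤ 2 := by
    rw [hdef, Fin.sum_univ_eq_sum_range fun i => (2 ^ i : ℝ)⁻¹]
    exact sum_range_inv_two_pow_le k
  have hsumG : ∑ i, G i ≤ 2 := by
    set z : Fin k := ⟨0, hk⟩
    have hG : ∀ i : Fin k, G i = (2 ^ (i : ℕ) : ℝ)⁻¹ *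
        (P (Function.update 0 z (2 ^ (i : ℕ))) z - P (Function.update 0 z 0) z) := fun i => by
      rw [← hPsym.update_zero i z (hh i).le, ← hPsym.update_zero i z le_rfl]
      simp [Gdef, hdef]
    rw [Finset.sum_congr rfl fun i _ => hG i, Fin.sum_univ_eq_sum_range fun i =>
      (2 ^ i : ℝ)⁻¹ * (P (Function.update 0 z (2 ^ i)) z - P (Function.update 0 z 0) z)]
    refine sum_range_payment_le (α := fun x => A (Function.update 0 z x) z)
      (g := fun x => P (Function.update 0 z x) z)
      (fun x hx => (hA _ (nonnegBids_update_zero z hx) z).1)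
      (fun x hx => (hA _ (nonnegBids_update_zero z hx) z).2) (fun x y hx hy => ?_) k
    have := hIC _ (nonnegBids_update_zero z hx) z y hy
    simpa using this
  calc (∫ v, ∑ i, P v i ∂(Measure.pi F))
      ≤ ∫ v, ∑ i, (G i * v i + ∑ j ∈ Finset.univ.erase i, (h j)⁻¹ * (v i * v j))
          ∂(Measure.pi F) := by
        refine integral_mono_ae hint
          (integrable_finsetSum _ fun i _ => hI4 i) ?_
        filter_upwards [hsupp] with v hv
        exact Finset.sum_le_sum fun i _ => payment_le_of_two_values hA hIC hIR hh hv i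
    _ = ∑ i, (G i * (k : ℝ)⁻¹
          + ∑ j ∈ Finset.univ.erase i, (h j)⁻¹ * ((k : ℝ)⁻¹ * (k : ℝ)⁻¹)) := by
        rw [integral_finsetSum _ fun i _ => hI4 i]
        refine Finset.sum_congr rfl fun i _ => ?_
        rw [integral_add (hI1 i) (hI3 i), integral_const_mul, hmean,
          integral_finsetSum _ (hI2 i)]
        congr 1
        refine Finset.sum_congr rfl fun j hj => ?_
        rw [integral_const_mul, hmean2 i j (Finset.ne_of_mem_erase hj).symm]
    _ ≤ ∑ i, (G i * (k : ℝ)⁻¹ + 2 * ((k : ℝ)⁻¹ * (k : ℝ)⁻¹)) := by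
        refine Finset.sum_le_sum fun i _ => ?_
        rw [← Finset.sum_mul]
        have : ∑ j ∈ Finset.univ.erase i, (h j)⁻¹ ≤ 2 :=
          (Finset.sum_le_sum_of_subset_of_nonneg (Finset.erase_subset _ _)
            fun j _ _ => inv_nonneg.2 (hh j).le).trans hsumh
        gcongr
    _ = (∑ i, G i) * (k : ℝ)⁻¹ + 2 * (k : ℝ)⁻¹ := by
        rw [Finset.sum_add_distrib, ← Finset.sum_mul]
        simp only [Finset.sum_const, Finset.card_univ, Fintype.card_fin, nsmul_eq_mul]
        field_simp
    _ ≤ 2 * (k : ℝ)⁻¹ + 2 * (k : ℝ)⁻¹ := by gcongr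
    _ = 4 / k := by ring
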